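/- (Sequence averaging lemma) Let A, B, C > 0, μ, L > 0 with β > 0 and βμ < L, and let {r_t}, {e_t}, {η_t} be non-negative sequences satisfying r_{t+1} ≤ exp(−μη_t/2)·r_t − η_t e_t A + η_t² B + η_t³ C for all t, where η_t = 6β/(L + βμt). Define ω_t = (η_t/η_0)·exp((μ/2)·Σ_{i=0}^t η_i) and S_T = Σ_{t=0}^T ω_t. Then for all T ≥ 1: (A/S_T)·Σ_{t=0}^T e_t ω_t ≤ (L³/(2β³μ²))·r_0/T³ + 18BL³(L + βμ(T+1))²/(β²(L − βμ)³μ³T³) + (108L³/(μ²(L − βμ)³))·C/T². -/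

import Mathlib

open Finset

/-- Exponentiating `3 m ∑ 1 / (L + m i)` grows at least like the cube of `L + m n`. -/
theorem pow_three_le_exp_sum {L m : ℝ} (hL : 0 < L) (hm : 0 < m) (n : ℕ) :
    ((L + m * n) / L) ^ 3 ≤ Real.exp (∑ i ∈ range n, 3 * (m / (L + m * i))) := by
  induction n with
  | zero => simp [hL.ne']
  | succ n ih =>
    have hd : 0 < L + m * n := by positivity
    rw [sum_range_succ, Real.exp_add]
    have h1 : (L + m * (n + 1 : ℕ)) / (L + m * n) ≤ Real.exp (m / (L + m * n)) := by
      have := Real.add_one_le_exp (m / (L + m * n))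
      refine le_trans (le_of_eq ?_) this
      push_cast
      field_simp
      ring
    have h2 : Real.exp (3 * (m / (L + m * n))) = Real.exp (m / (L + m * n)) ^ 3 := by
      rw [← Real.exp_nat_mul]
      norm_num
    rw [h2]
    calc ((L + m * (n + 1 : ℕ)) / L) ^ 3
        = ((L + m * n) / L) ^ 3 * ((L + m * (n + 1 : ℕ)) / (L + m * n)) ^ 3 := by
          field_simp
      _ ≤ _ := by gcongr

/-- Exponentiating `3 m ∑ 1 / (L + m i)` grows at most like the cube of `L + m (n - 1)`. -/
theorem exp_sum_le_pow_three {L m : ℝ} (hm : 0 < m) (hmL : m < L) (n : ℕ) :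
    Real.exp (∑ i ∈ range n, 3 * (m / (L + m * i))) ≤ ((L + m * n - m) / (L - m)) ^ 3 := by
  have hs : 0 < L - m := sub_pos.2 hmL
  induction n with
  | zero => simp [hs.ne']
  | succ n ih =>
    have hn : 0 ≤ m * n := by positivity
    have hd : 0 < L + m * n := by linarith
    have hd' : 0 < L + m * n - m := by linarith
    rw [sum_range_succ, Real.exp_add]
    have h1 : Real.exp (m / (L + m * n)) ≤ (L + m * n) / (L + m * n - m) := by
      have h := Real.add_one_le_exp (-(m / (L + m * n)))
      rw [Real.exp_neg] at h
      have h3 : (L + m * n - m) / (L + m * n) ≤ (Real.exp (m / (L + m * n)))⁻¹ := by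
        refine le_trans (le_of_eq ?_) h
        field_simp
        ring
      have := (le_inv_comm₀ (by positivity) (Real.exp_pos _)).1 h3
      rwa [inv_div] at this
    have h2 : Real.exp (3 * (m / (L + m * n))) = Real.exp (m / (L + m * n)) ^ 3 := by
      rw [← Real.exp_nat_mul]
      norm_num
    rw [h2]
    calc _ ≤ ((L + m * n - m) / (L - m)) ^ 3 * ((L + m * n) / (L + m * n - m)) ^ 3 := by
          gcongr
      _ = _ := by
          push_cast
          rw [← mul_pow]
          congr 1
          field_simp
          ring

/-- Telescoping a linear recursion with contraction factors `exp (-a t)`. -/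
theorem sum_mul_exp_le_of_recursion {r a f g : ℕ → ℝ}
    (h : ∀ t, r (t + 1) ≤ Real.exp (-a t) * r t - f t + g t) (n : ℕ) :
    ∑ t ∈ range n, f t * Real.exp (∑ i ∈ range (t + 1), a i)
      + Real.exp (∑ i ∈ range n, a i) * r n ≤
    r 0 + ∑ t ∈ range n, g t * Real.exp (∑ i ∈ range (t + 1), a i) := by
  induction n with
  | zero => simp
  | succ n ih =>
    rw [sum_range_succ, sum_range_succ (fun t => g t * _)]
    have h1 := mul_le_mul_of_nonneg_left (h n) (Real.exp_pos (∑ i ∈ range (n + 1), a i)).le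
    have h2 : Real.exp (∑ i ∈ range (n + 1), a i) * Real.exp (-a n) =
        Real.exp (∑ i ∈ range n, a i) := by
      rw [← Real.exp_add, sum_range_succ]
      congr 1
      ring
    have h3 : Real.exp (∑ i ∈ range (n + 1), a i) * (Real.exp (-a n) * r n - f n + g n) =
        Real.exp (∑ i ∈ range n, a i) * r n - f n * Real.exp (∑ i ∈ range (n + 1), a i)
          + g n * Real.exp (∑ i ∈ range (n + 1), a i) := by
      rw [← h2]
      ring
    linarith

theorem sum_range_succ_sq (n : ℕ) :
    ∑ t ∈ range n, ((t : ℝ) + 1) ^ 2 = (n : ℝ) * (n + 1) * (2 * n + 1) / 6 := by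
  induction n with
  | zero => simp
  | succ n ih =>
    rw [sum_range_succ, ih]
    push_cast
    ring

theorem sum_range_affine_le (L : ℝ) {m : ℝ} (hm : 0 < m) (n : ℕ) :
    ∑ t ∈ range n, (L + m * t) ≤ (L + m * n) ^ 2 / (2 * m) := by
  rw [le_div_iff₀ (by positivity)]
  induction n with
  | zero => simpa using sq_nonneg L
  | succ n ih =>
    rw [sum_range_succ]
    push_cast
    nlinarith [sq_nonneg m]

/-- **Sequence averaging lemma** (Lemma `lem:av` of the paper). -/
theorem statement_18
    (A B C μ L β : ℝ)
    (hA : 0 < A) (hB : 0 < B) (hC : 0 < C)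
    (hμ : 0 < μ) (hL : 0 < L) (hβ : 0 < β) (hβμ : β * μ < L)
    (r e η w S : ℕ → ℝ)
    (hr : ∀ t, 0 ≤ r t) (he : ∀ t, 0 ≤ e t)
    (hη : ∀ t, η t = 6 * β / (L + β * μ * (t : ℝ)))
    (hrec : ∀ t, r (t + 1) ≤
      Real.exp (-(μ * η t) / 2) * r t - η t * e t * A + (η t) ^ 2 * B + (η t) ^ 3 * C)
    (hw : ∀ t, w t = (η t / η 0) * Real.exp ((μ / 2) * ∑ i ∈ Finset.range (t + 1), η i))
    (hS : ∀ T, S T = ∑ t ∈ Finset.range (T + 1), w t) :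
    ∀ T : ℕ, 1 ≤ T →
      (A / S T) * ∑ t ∈ Finset.range (T + 1), e t * w t ≤
        (L ^ 3 / (2 * β ^ 3 * μ ^ 2)) * r 0 / (T : ℝ) ^ 3
        + 18 * B * L ^ 3 * (L + β * μ * ((T : ℝ) + 1)) ^ 2
            / (β ^ 2 * (L - β * μ) ^ 3 * μ ^ 3 * (T : ℝ) ^ 3)
        + (108 * L ^ 3 / (μ ^ 2 * (L - β * μ) ^ 3)) * C / (T : ℝ) ^ 2 := by
  intro T hT
  have hm : 0 < β * μ := mul_pos hβ hμ
  have hs : 0 < L - β * μ := sub_pos.2 hβμ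
  have hT0 : (0 : ℝ) < T := by exact_mod_cast hT
  have hd (t : ℕ) : 0 < L + β * μ * (t : ℝ) := by positivity
  have hη0 : η 0 = 6 * β / L := by simp [hη]
  have hηpos (t : ℕ) : 0 < η t := by
    rw [hη]
    exact div_pos (by positivity) (hd t)
  set F : ℕ → ℝ := fun t => Real.exp (∑ i ∈ range (t + 1), μ * η i / 2) with hF
  have hwF (t : ℕ) : w t = η t / η 0 * F t := by
    rw [hw, hF]
    simp only [mul_sum]
    congr 2
    exact sum_congr rfl fun i _ => by ring
  have hFsum (t : ℕ) :
      F t = Real.exp (∑ i ∈ range (t + 1), 3 * (β * μ / (L + β * μ * i))) := by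
    simp only [hF]
    congr 1
    exact sum_congr rfl fun i _ => by rw [hη]; ring
  have hFlow (t : ℕ) : ((L + β * μ * (t + 1)) / L) ^ 3 ≤ F t := by
    rw [hFsum]
    exact_mod_cast pow_three_le_exp_sum hL hm (t + 1)
  have hFup (t : ℕ) : F t ≤ ((L + β * μ * t) / (L - β * μ)) ^ 3 := by
    rw [hFsum]
    refine (exp_sum_le_pow_three hm hβμ (t + 1)).trans (le_of_eq ?_)
    push_cast
    ring
  have hwlow (t : ℕ) : (β * μ / L) ^ 2 * ((t : ℝ) + 1) ^ 2 ≤ w t := by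
    have hdt := hd t
    have hd1 : L + β * μ * t ≤ L + β * μ * (t + 1) := by nlinarith
    have hd2 : β * μ * (t + 1) ≤ L + β * μ * (t + 1) := by linarith
    calc (β * μ / L) ^ 2 * ((t : ℝ) + 1) ^ 2 = (β * μ * (t + 1)) ^ 2 / L ^ 2 := by
          rw [← mul_pow, ← div_pow]
          ring
      _ ≤ (L + β * μ * (t + 1)) ^ 2 / L ^ 2 := by gcongr
      _ = L / (L + β * μ * (t + 1)) * ((L + β * μ * (t + 1)) / L) ^ 3 := by
          field_simp
      _ ≤ L / (L + β * μ * t) * F t := by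
          gcongr
          exact hFlow t
      _ = w t := by
          rw [hwF, hη0, hη]
          field_simp
  have hSlow : (β * μ / L) ^ 2 * ((T + 1) * (T : ℝ) ^ 2 / 3) ≤ S T := by
    calc (β * μ / L) ^ 2 * ((T + 1) * (T : ℝ) ^ 2 / 3)
        ≤ (β * μ / L) ^ 2 * ∑ t ∈ range (T + 1), ((t : ℝ) + 1) ^ 2 := by
          rw [sum_range_succ_sq]
          refine mul_le_mul_of_nonneg_left ?_ (by positivity)
          push_cast
          nlinarith [mul_pos hT0 hT0, mul_pos hT0 (mul_pos hT0 hT0)]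
      _ ≤ S T := by
          rw [hS, mul_sum]
          exact sum_le_sum fun t _ => hwlow t
  have hSlow' : (β * μ / L) ^ 2 * ((T : ℝ) ^ 3 / 3) ≤ S T := by
    refine le_trans ?_ hSlow
    gcongr
    nlinarith [mul_pos hT0 hT0]
  have hSpos : 0 < S T := lt_of_lt_of_le (by positivity) hSlow'
  have hBsum : ∑ t ∈ range (T + 1), η t * w t ≤
      6 * β * L / (L - β * μ) ^ 3 * ((L + β * μ * (T + 1)) ^ 2 / (2 * (β * μ))) := by
    calc ∑ t ∈ range (T + 1), η t * w t
        ≤ ∑ t ∈ range (T + 1), 6 * β * L / (L - β * μ) ^ 3 * (L + β * μ * t) := by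
          refine sum_le_sum fun t _ => ?_
          have hdt := hd t
          calc η t * w t = 6 * β * L / (L + β * μ * t) ^ 2 * F t := by
                rw [hwF, hη0, hη]
                field_simp
            _ ≤ 6 * β * L / (L + β * μ * t) ^ 2 * ((L + β * μ * t) / (L - β * μ)) ^ 3 := by
                gcongr
                exact hFup t
            _ = _ := by field_simp
      _ ≤ _ := by
          rw [← mul_sum]
          gcongr
          exact_mod_cast sum_range_affine_le L hm (T + 1)
  have hCsum : ∑ t ∈ range (T + 1), η t ^ 2 * w t ≤
      (T + 1) * (36 * β ^ 2 * L / (L - β * μ) ^ 3) := by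
    calc ∑ t ∈ range (T + 1), η t ^ 2 * w t
        ≤ ∑ t ∈ range (T + 1), 36 * β ^ 2 * L / (L - β * μ) ^ 3 := by
          refine sum_le_sum fun t _ => ?_
          have hdt := hd t
          calc η t ^ 2 * w t = 36 * β ^ 2 * L / (L + β * μ * t) ^ 3 * F t := by
                rw [hwF, hη0, hη]
                field_simp
                ring
            _ ≤ 36 * β ^ 2 * L / (L + β * μ * t) ^ 3
                  * ((L + β * μ * t) / (L - β * μ)) ^ 3 := by
                gcongr
                exact hFup t
            _ = _ := by field_simp
      _ = _ := by simp
  have hsum : A * ∑ t ∈ range (T + 1), e t * w t ≤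
      r 0 / η 0 + B * ∑ t ∈ range (T + 1), η t * w t
        + C * ∑ t ∈ range (T + 1), η t ^ 2 * w t := by
    have h := sum_mul_exp_le_of_recursion (r := r) (a := fun t => μ * η t / 2)
      (f := fun t => η t * e t * A) (g := fun t => η t ^ 2 * B + η t ^ 3 * C)
      (fun t => by have := hrec t; rw [neg_div] at this; linarith) (T + 1)
    have hlast : 0 ≤ Real.exp (∑ i ∈ range (T + 1), μ * η i / 2) * r (T + 1) :=
      mul_nonneg (Real.exp_pos _).le (hr _)
    have h' := div_le_div_of_nonneg_right
      ((le_add_of_nonneg_right hlast).trans h) (hηpos 0).le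
    calc A * ∑ t ∈ range (T + 1), e t * w t
        = (∑ t ∈ range (T + 1), η t * e t * A * F t) / η 0 := by
          rw [mul_sum, sum_div]
          exact sum_congr rfl fun t _ => by rw [hwF]; ring
      _ ≤ _ := h'
      _ = _ := by
          rw [add_div, sum_div, mul_sum, mul_sum, add_assoc, ← sum_add_distrib]
          congr 1
          exact sum_congr rfl fun t _ => by rw [hwF]; ring
  have hr0 := hr 0
  calc (A / S T) * ∑ t ∈ range (T + 1), e t * w t
      = (A * ∑ t ∈ range (T + 1), e t * w t) / S T := by ring
    _ ≤ (r 0 / η 0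
        + B * (6 * β * L / (L - β * μ) ^ 3 * ((L + β * μ * (T + 1)) ^ 2 / (2 * (β * μ))))
        + C * ((T + 1) * (36 * β ^ 2 * L / (L - β * μ) ^ 3))) / S T := by
        refine div_le_div_of_nonneg_right (hsum.trans ?_) hSpos.le
        gcongr
    _ = r 0 / η 0 / S T
        + B * (6 * β * L / (L - β * μ) ^ 3 * ((L + β * μ * (T + 1)) ^ 2 / (2 * (β * μ)))) / S T
        + C * ((T + 1) * (36 * β ^ 2 * L / (L - β * μ) ^ 3)) / S T := by
        rw [add_div, add_div]
    _ ≤ _ := by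
        refine add_le_add (add_le_add ?_ ?_) ?_
        · calc r 0 / η 0 / S T ≤ r 0 / η 0 / ((β * μ / L) ^ 2 * ((T : ℝ) ^ 3 / 3)) := by
                have := hηpos 0
                gcongr
            _ = _ := by
                rw [hη0]
                field_simp
                ring
        · calc B * (6 * β * L / (L - β * μ) ^ 3
                  * ((L + β * μ * (T + 1)) ^ 2 / (2 * (β * μ)))) / S T
              ≤ B * (6 * β * L / (L - β * μ) ^ 3
                  * ((L + β * μ * (T + 1)) ^ 2 / (2 * (β * μ))))
                  / ((β * μ / L) ^ 2 * ((T : ℝ) ^ 3 / 3)) := by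
                gcongr
            _ = 9 * B * L ^ 3 * (L + β * μ * ((T : ℝ) + 1)) ^ 2
                  / (β ^ 2 * (L - β * μ) ^ 3 * μ ^ 3 * (T : ℝ) ^ 3) := by
                field_simp
                norm_num
            _ ≤ _ := by
                gcongr
                norm_num
        · calc C * ((T + 1) * (36 * β ^ 2 * L / (L - β * μ) ^ 3)) / S T
              ≤ C * ((T + 1) * (36 * β ^ 2 * L / (L - β * μ) ^ 3))
                  / ((β * μ / L) ^ 2 * ((T + 1) * (T : ℝ) ^ 2 / 3)) := by
                gcongr
            _ = _ := by
                field_simp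
                norm_num
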